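/- Let U : ℕ × ℤ → ℝ^r solve the semi-implicit upwind scheme with grid sizes satisfying the CFL condition, with initial total variation ∑_j |U_j^0 − U_{j−1}^0| finite and U_j^0 = 0 for all sufficiently large j, and assume Assumption (★). Then there exists a constant C > 0, independent of n, Δt, Δx and ε, such that for all n ≥ 0: ∑_{j∈ℤ} |Q(U_j^n)| Δx ≤ C ( (1 + λΔt/ε)^{−n} ∑_{j∈ℤ} |Q(U_j^0)| Δx + ε ). -/

import Mathlib

open scoped BigOperators

noncomputable section

/-- The 1-norm `|V| = ∑ i |v_i|` on `ℝ^r`. -/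
def onenorm {r : ℕ} (V : Fin r → ℝ) : ℝ := ∑ i, |V i|

/-- The reaction term `Q(U) = (f_1, f_2 - f_1, …, f_i - f_{i-1}, …, -f_{r-1})`
for `U ∈ ℝ^r` with `r = m + 2`, built from `f_i = f_i (u_i, u_{i+1})`. -/
def Qr (m : ℕ) (f : Fin (m + 1) → ℝ → ℝ → ℝ) (U : Fin (m + 2) → ℝ) :
    Fin (m + 2) → ℝ :=
  fun k =>
    (∑ i : Fin (m + 1), if k = i.castSucc then f i (U i.castSucc) (U i.succ) else 0)
      - ∑ i : Fin (m + 1), if k = i.succ then f i (U i.castSucc) (U i.succ) else 0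

/-- The semi-implicit upwind scheme
`(U_j^{n+1} - U_j^n)/Δt + Λ⁺(U_j^n - U_{j-1}^n)/Δx + Λ⁻(U_{j+1}^n - U_j^n)/Δx
  = (1/ε) Q(U_j^{n+1})`,
where `λ_i^± = (λ_i ± |λ_i|)/2` and `Λ^± = diag(λ_1^±, …, λ_r^±)`. -/
def Scheme (m : ℕ) (f : Fin (m + 1) → ℝ → ℝ → ℝ) (lam : Fin (m + 2) → ℝ)
    (Δt Δx ε : ℝ) (U : ℕ → ℤ → Fin (m + 2) → ℝ) : Prop :=
  ∀ (n : ℕ) (j : ℤ) (i : Fin (m + 2)),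
    (U (n + 1) j i - U n j i) / Δt
      + (lam i + |lam i|) / 2 * (U n j i - U n (j - 1) i) / Δx
      + (lam i - |lam i|) / 2 * (U n (j + 1) i - U n j i) / Δx
    = (1 / ε) * Qr m f (U (n + 1) j) i

/-- The CFL condition `(Δt/Δx) · max_i |λ_i| ≤ 1`. -/
def CFL (m : ℕ) (lam : Fin (m + 2) → ℝ) (Δt Δx : ℝ) : Prop :=
  ∀ i, Δt / Δx * |lam i| ≤ 1

/-- `A_i(V, W) = ∫₀¹ ∂₁f_i(θv_i + (1-θ)w_i, θv_{i+1} + (1-θ)w_{i+1}) dθ`. -/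
def Aint (m : ℕ) (f : Fin (m + 1) → ℝ → ℝ → ℝ) (V W : Fin (m + 2) → ℝ)
    (i : Fin (m + 1)) : ℝ :=
  ∫ θ in (0 : ℝ)..1,
    deriv (fun v => f i v (θ * V i.succ + (1 - θ) * W i.succ))
      (θ * V i.castSucc + (1 - θ) * W i.castSucc)

/-- `B_i(V, W) = ∫₀¹ ∂₂f_i(θv_i + (1-θ)w_i, θv_{i+1} + (1-θ)w_{i+1}) dθ`. -/
def Bint (m : ℕ) (f : Fin (m + 1) → ℝ → ℝ → ℝ) (V W : Fin (m + 2) → ℝ)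
    (i : Fin (m + 1)) : ℝ :=
  ∫ θ in (0 : ℝ)..1,
    deriv (fun w => f i (θ * V i.castSucc + (1 - θ) * W i.castSucc) w)
      (θ * V i.succ + (1 - θ) * W i.succ)

/-- The `(r-1) × (r-1)` tridiagonal matrix `M(V, W)` with diagonal entries `A_i - B_i`,
superdiagonal entries `B_i` and subdiagonal entries `-A_{i+1}`. -/
def Mmat (m : ℕ) (f : Fin (m + 1) → ℝ → ℝ → ℝ) (V W : Fin (m + 2) → ℝ) :
    Matrix (Fin (m + 1)) (Fin (m + 1)) ℝ :=
  fun k l =>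
    if l = k then Aint m f V W k - Bint m f V W k
    else if (l : ℕ) = (k : ℕ) + 1 then Bint m f V W k
    else if (k : ℕ) = (l : ℕ) + 1 then -Aint m f V W k
    else 0

/-- **Assumption (★).** `N` is a norm `|·|_⋆` on `ℝ^{r-1}` and `lam0 = λ > 0` is such that
for all `V, W ∈ ℝ^r` and all `Δt, ε > 0` the matrix `I - (Δt/ε) M(V, W)` is invertible and
the `⋆`-operator norm of its inverse is at most `(1 + λΔt/ε)⁻¹`. -/
def StarAssumption (m : ℕ) (f : Fin (m + 1) → ℝ → ℝ → ℝ)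
    (N : (Fin (m + 1) → ℝ) → ℝ) (lam0 : ℝ) : Prop :=
  (∀ x, 0 ≤ N x) ∧ (∀ x, N x = 0 ↔ x = 0) ∧
  (∀ (c : ℝ) (x), N (c • x) = |c| * N x) ∧
  (∀ x y, N (x + y) ≤ N x + N y) ∧
  0 < lam0 ∧
  ∀ (V W : Fin (m + 2) → ℝ) (Δt ε : ℝ), 0 < Δt → 0 < ε →
    IsUnit (1 - (Δt / ε) • Mmat m f V W) ∧
    ∀ ξ : Fin (m + 1) → ℝ,
      N ((1 - (Δt / ε) • Mmat m f V W)⁻¹.mulVec ξ)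
        ≤ (1 + lam0 * Δt / ε)⁻¹ * N ξ

end

noncomputable def Fv (m : ℕ) (f : Fin (m + 1) → ℝ → ℝ → ℝ) (U : Fin (m + 2) → ℝ) :
    Fin (m + 1) → ℝ := fun i => f i (U i.castSucc) (U i.succ)

theorem onenorm_nonneg' {r : ℕ} (V : Fin r → ℝ) : 0 ≤ onenorm V :=
  Finset.sum_nonneg fun _ _ => abs_nonneg _

theorem abs_le_onenorm {r : ℕ} (V : Fin r → ℝ) (i : Fin r) : |V i| ≤ onenorm V :=
  Finset.single_le_sum (f := fun i => |V i|) (fun _ _ => abs_nonneg _) (Finset.mem_univ i)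

theorem onenorm_add_le {r : ℕ} (V W : Fin r → ℝ) : onenorm (V + W) ≤ onenorm V + onenorm W := by
  unfold onenorm
  rw [← Finset.sum_add_distrib]
  exact Finset.sum_le_sum fun i _ => abs_add_le _ _

theorem Qr_castSucc (m : ℕ) (f : Fin (m + 1) → ℝ → ℝ → ℝ) (U : Fin (m + 2) → ℝ) (i : Fin (m + 1)) :
    Qr m f U i.castSucc = ∑ l : Fin (m + 1), ((if l = i then (1 : ℝ) else 0)
      - (if (i : ℕ) = (l : ℕ) + 1 then 1 else 0)) * Fv m f U l := by
  unfold Qr Fv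
  rw [← Finset.sum_sub_distrib]
  refine Finset.sum_congr rfl fun l _ => ?_
  have h1 : (i.castSucc = l.castSucc) ↔ l = i := by
    rw [Fin.castSucc_inj]; exact eq_comm
  have h2 : (i.castSucc = l.succ) ↔ (i : ℕ) = (l : ℕ) + 1 := by
    rw [Fin.ext_iff]; simp
  simp only [h1, h2]
  split_ifs <;> ring

theorem Qr_succ (m : ℕ) (f : Fin (m + 1) → ℝ → ℝ → ℝ) (U : Fin (m + 2) → ℝ) (i : Fin (m + 1)) :
    Qr m f U i.succ = ∑ l : Fin (m + 1), ((if (l : ℕ) = (i : ℕ) + 1 then (1 : ℝ) else 0)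
      - (if l = i then 1 else 0)) * Fv m f U l := by
  unfold Qr Fv
  rw [← Finset.sum_sub_distrib]
  refine Finset.sum_congr rfl fun l _ => ?_
  have h1 : (i.succ = l.succ) ↔ l = i := by
    rw [Fin.succ_inj]; exact eq_comm
  have h2 : (i.succ = l.castSucc) ↔ (l : ℕ) = (i : ℕ) + 1 := by
    rw [Fin.ext_iff]; simp; exact eq_comm
  simp only [h1, h2]
  split_ifs <;> ring

theorem M_mulVec (m : ℕ) (f : Fin (m + 1) → ℝ → ℝ → ℝ) (V W U : Fin (m + 2) → ℝ)
    (i : Fin (m + 1)) :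
    (Mmat m f V W).mulVec (Fv m f U) i
      = Aint m f V W i * Qr m f U i.castSucc + Bint m f V W i * Qr m f U i.succ := by
  rw [Qr_castSucc, Qr_succ, Finset.mul_sum, Finset.mul_sum, ← Finset.sum_add_distrib]
  unfold Matrix.mulVec dotProduct
  refine Finset.sum_congr rfl fun l _ => ?_
  unfold Mmat
  by_cases h : l = i
  · subst h; simp; ring
  · by_cases h1 : (l : ℕ) = i + 1
    · have h2 : ¬ (i : ℕ) = l + 1 := by omega
      simp only [if_neg h, if_pos h1, if_neg h2]; ring
    · by_cases h2 : (i : ℕ) = l + 1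
      · simp only [if_neg h, if_neg h1, if_pos h2]; ring
      · simp only [if_neg h, if_neg h1, if_neg h2]; ring

/-- pairing with Q -/
theorem sum_mul_Qr (m : ℕ) (f : Fin (m + 1) → ℝ → ℝ → ℝ) (U s : Fin (m + 2) → ℝ) :
    ∑ k, s k * Qr m f U k = ∑ i : Fin (m + 1), (s i.castSucc - s i.succ) * Fv m f U i := by
  unfold Qr Fv
  simp only [mul_sub, Finset.mul_sum, Finset.sum_sub_distrib, sub_mul]
  congr 1
  · rw [Finset.sum_comm]
    refine Finset.sum_congr rfl fun i _ => ?_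
    simp
  · rw [Finset.sum_comm]
    refine Finset.sum_congr rfl fun i _ => ?_
    simp

theorem sign_mul_le (x y : ℝ) : ((SignType.sign x : SignType) : ℝ) * y ≤ |y| := by
  rcases lt_trichotomy x 0 with h | h | h
  · simp [h]; exact neg_le_abs y
  · simp [h]
  · simp [h]; exact le_abs_self y

theorem Q_dissip (m : ℕ) (f : Fin (m + 1) → ℝ → ℝ → ℝ)
    (hf2 : ∀ i w, StrictAnti fun v => f i v w)
    (hf3 : ∀ i v, StrictMono fun w => f i v w) (V W : Fin (m + 2) → ℝ) :
    ∑ k, ((SignType.sign (V k - W k) : SignType) : ℝ) * (Qr m f V k - Qr m f W k) ≤ 0 := by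
  simp only [mul_sub, Finset.sum_sub_distrib]
  rw [sum_mul_Qr m f V (fun k => ((SignType.sign (V k - W k) : SignType) : ℝ)),
    sum_mul_Qr m f W (fun k => ((SignType.sign (V k - W k) : SignType) : ℝ)),
    ← Finset.sum_sub_distrib]
  refine Finset.sum_nonpos fun i _ => ?_
  rw [← mul_sub]
  unfold Fv
  set a := V i.castSucc
  set b := V i.succ
  set c := W i.castSucc
  set d := W i.succ
  have dec : c ≤ a → b ≤ d → f i a b - f i c d ≤ 0 := fun h1 h2 => by
    have := (hf2 i b).antitone h1
    have := (hf3 i c).monotone h2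
    linarith
  have inc : a ≤ c → d ≤ b → 0 ≤ f i a b - f i c d := fun h1 h2 => by
    have := (hf2 i b).antitone h1
    have := (hf3 i c).monotone h2
    linarith
  rcases lt_trichotomy a c with h | h | h <;> rcases lt_trichotomy b d with h' | h' | h'
  · rw [sign_neg (by linarith), sign_neg (by linarith)]; simp
  · have := inc h.le h'.ge
    rw [sign_neg (by linarith), h', sub_self, sign_zero]; rw [h'] at this; simp at *; linarith
  · have := inc h.le h'.le
    rw [sign_neg (by linarith), sign_pos (by linarith)]; simp at *; linarith
  · have := dec h.ge h'.le
    rw [h, sub_self, sign_zero, sign_neg (by linarith)]; rw [h] at this; simp at *; linarith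
  · rw [h, h']; simp
  · have := inc h.le h'.le
    rw [h, sub_self, sign_zero, sign_pos (by linarith)]; rw [h] at this; simp at *; linarith
  · have := dec h.le h'.le
    rw [sign_pos (by linarith), sign_neg (by linarith)]; simp at *; linarith
  · have := dec h.le h'.le
    rw [sign_pos (by linarith), h', sub_self, sign_zero]; rw [h'] at this; simp at *; linarith
  · rw [sign_pos (by linarith), sign_pos (by linarith)]; simp

theorem implicit_contr (m : ℕ) (f : Fin (m + 1) → ℝ → ℝ → ℝ)
    (hf2 : ∀ i w, StrictAnti fun v => f i v w)
    (hf3 : ∀ i v, StrictMono fun w => f i v w) (V W X Y : Fin (m + 2) → ℝ) (t : ℝ) (ht : 0 ≤ t)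
    (hV : ∀ k, V k = X k + t * Qr m f V k) (hW : ∀ k, W k = Y k + t * Qr m f W k) :
    onenorm (V - W) ≤ onenorm (X - Y) := by
  have h := Q_dissip m f hf2 hf3 V W
  have e : onenorm (V - W) = ∑ k, ((SignType.sign (V k - W k) : SignType) : ℝ) * (X k - Y k)
      + t * ∑ k, ((SignType.sign (V k - W k) : SignType) : ℝ) * (Qr m f V k - Qr m f W k) := by
    unfold onenorm
    rw [Finset.mul_sum, ← Finset.sum_add_distrib]
    refine Finset.sum_congr rfl fun k _ => ?_
    rw [Pi.sub_apply, ← sign_mul_self (V k - W k)]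
    have : V k - W k = X k - Y k + t * (Qr m f V k - Qr m f W k) := by
      linarith [hV k, hW k]
    calc ((SignType.sign (V k - W k) : SignType) : ℝ) * (V k - W k)
        = ((SignType.sign (V k - W k) : SignType) : ℝ) *
          (X k - Y k + t * (Qr m f V k - Qr m f W k)) := by rw [← this]
      _ = _ := by ring
  rw [e]
  have h2 : ∑ k, ((SignType.sign (V k - W k) : SignType) : ℝ) * (X k - Y k) ≤ onenorm (X - Y) :=
    Finset.sum_le_sum fun k _ => sign_mul_le _ _
  nlinarith


theorem partial1 (g : ℝ → ℝ → ℝ) (hg : ContDiff ℝ 1 fun p : ℝ × ℝ => g p.1 p.2)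
    (a b : ℝ) : HasDerivAt (fun v => g v b)
    (fderiv ℝ (fun p : ℝ × ℝ => g p.1 p.2) (a, b) (1, 0)) a := by
  have h := (hg.differentiable (by norm_num) (a, b)).hasFDerivAt
  have h2 : HasDerivAt (fun v : ℝ => (v, b)) ((1 : ℝ), (0 : ℝ)) a :=
    (hasDerivAt_id a).prodMk (hasDerivAt_const a b)
  exact h.comp_hasDerivAt a h2

theorem partial2 (g : ℝ → ℝ → ℝ) (hg : ContDiff ℝ 1 fun p : ℝ × ℝ => g p.1 p.2)
    (a b : ℝ) : HasDerivAt (fun w => g a w)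
    (fderiv ℝ (fun p : ℝ × ℝ => g p.1 p.2) (a, b) (0, 1)) b := by
  have h := (hg.differentiable (by norm_num) (a, b)).hasFDerivAt
  have h2 : HasDerivAt (fun w : ℝ => (a, w)) ((0 : ℝ), (1 : ℝ)) b :=
    (hasDerivAt_const b a).prodMk (hasDerivAt_id b)
  exact h.comp_hasDerivAt b h2

theorem cont_p (g : ℝ → ℝ → ℝ) (hg : ContDiff ℝ 1 fun p : ℝ × ℝ => g p.1 p.2)
    (e : ℝ × ℝ) :
    Continuous fun p : ℝ × ℝ => fderiv ℝ (fun p : ℝ × ℝ => g p.1 p.2) p e :=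
  (hg.continuous_fderiv (by norm_num)).clm_apply continuous_const

theorem bdd_p (g : ℝ → ℝ → ℝ) (hg : ContDiff ℝ 1 fun p : ℝ × ℝ => g p.1 p.2)
    (R : ℝ) (e : ℝ × ℝ) : ∃ K : ℝ, 0 ≤ K ∧ ∀ a b : ℝ, |a| ≤ R → |b| ≤ R →
    |fderiv ℝ (fun p : ℝ × ℝ => g p.1 p.2) (a, b) e| ≤ K := by
  obtain ⟨K, hK⟩ := ((isCompact_Icc (a := -R) (b := R)).prod
    (isCompact_Icc (a := -R) (b := R))).exists_bound_of_continuousOn (cont_p g hg e).continuousOn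
  refine ⟨max K 0, le_max_right _ _, fun a b ha hb => le_trans ?_ (le_max_left _ _)⟩
  exact hK (a, b) ⟨abs_le.1 ha, abs_le.1 hb⟩

theorem ftc (g : ℝ → ℝ → ℝ) (hg : ContDiff ℝ 1 fun p : ℝ × ℝ => g p.1 p.2)
    (v1 v2 w1 w2 : ℝ) : g v1 v2 - g w1 w2 =
    (∫ θ in (0 : ℝ)..1, deriv (fun v => g v (θ * v2 + (1 - θ) * w2)) (θ * v1 + (1 - θ) * w1))
      * (v1 - w1)
    + (∫ θ in (0 : ℝ)..1, deriv (fun w => g (θ * v1 + (1 - θ) * w1) w) (θ * v2 + (1 - θ) * w2))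
      * (v2 - w2) := by
  simp only [fun a b => (partial1 g hg a b).deriv, fun a b => (partial2 g hg a b).deriv]
  have c1 : ∀ e, Continuous fun θ : ℝ => fderiv ℝ (fun p : ℝ × ℝ => g p.1 p.2)
    (θ * v1 + (1 - θ) * w1, θ * v2 + (1 - θ) * w2) e := fun e =>
    (cont_p g hg e).comp (by fun_prop)
  rw [← intervalIntegral.integral_mul_const, ← intervalIntegral.integral_mul_const,
    ← intervalIntegral.integral_add]
  rotate_left
  · exact (((c1 _).mul continuous_const).intervalIntegrable _ _)
  · exact (((c1 _).mul continuous_const).intervalIntegrable _ _)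
  rw [intervalIntegral.integral_eq_sub_of_hasDerivAt
    (f := fun θ : ℝ => g (θ * v1 + (1 - θ) * w1) (θ * v2 + (1 - θ) * w2))]
  · simp
  · intro θ _
    have h := (hg.differentiable (by norm_num)
      (θ * v1 + (1 - θ) * w1, θ * v2 + (1 - θ) * w2)).hasFDerivAt
    have l : ∀ v w : ℝ, HasDerivAt (fun θ : ℝ => θ * v + (1 - θ) * w) (v - w) θ := fun v w => by
      have := ((hasDerivAt_id θ).mul_const v).add
        (((hasDerivAt_const θ (1 : ℝ)).sub (hasDerivAt_id θ)).mul_const w)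
      exact this.congr_deriv (by ring)
    refine (HasFDerivAt.comp_hasDerivAt θ h ((l v1 w1).prodMk (l v2 w2))).congr_deriv ?_
    have : ((v1 - w1, v2 - w2) : ℝ × ℝ) = (v1 - w1) • ((1 : ℝ), (0 : ℝ)) + (v2 - w2) • ((0 : ℝ), (1 : ℝ)) := by
      simp
    rw [this, map_add, map_smul, map_smul]
    simp only [smul_eq_mul]
    ring
  · exact (((c1 _).mul continuous_const).add ((c1 _).mul continuous_const)).intervalIntegrable _ _


theorem seg_abs {v w R θ : ℝ} (h0 : 0 ≤ θ) (h1 : θ ≤ 1) (hv : |v| ≤ R) (hw : |w| ≤ R) :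
    |θ * v + (1 - θ) * w| ≤ R := by
  rw [abs_le] at *
  constructor <;> nlinarith

theorem AB_bdd (m : ℕ) (f : Fin (m + 1) → ℝ → ℝ → ℝ)
    (hf1 : ∀ i, ContDiff ℝ 1 fun p : ℝ × ℝ => f i p.1 p.2) (R : ℝ) :
    ∃ K : ℝ, 0 ≤ K ∧ ∀ V W : Fin (m + 2) → ℝ, (∀ i, |V i| ≤ R) → (∀ i, |W i| ≤ R) →
      ∀ i, |Aint m f V W i| ≤ K ∧ |Bint m f V W i| ≤ K := by
  choose K1 hK1 h1 using fun i => bdd_p (f i) (hf1 i) R (1, 0)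
  choose K2 hK2 h2 using fun i => bdd_p (f i) (hf1 i) R (0, 1)
  have e1 : ∀ i, K1 i ≤ ∑ i, K1 i := fun i =>
    Finset.single_le_sum (fun i _ => hK1 i) (Finset.mem_univ i)
  have e2 : ∀ i, K2 i ≤ ∑ i, K2 i := fun i =>
    Finset.single_le_sum (fun i _ => hK2 i) (Finset.mem_univ i)
  have p1 : 0 ≤ ∑ i, K1 i := Finset.sum_nonneg fun i _ => hK1 i
  have p2 : 0 ≤ ∑ i, K2 i := Finset.sum_nonneg fun i _ => hK2 i
  refine ⟨∑ i, K1 i + ∑ i, K2 i, by positivity, fun V W hV hW i => ⟨?_, ?_⟩⟩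
  · have := intervalIntegral.norm_integral_le_of_norm_le_const (a := (0 : ℝ)) (b := 1) (C := K1 i)
      (f := fun θ => deriv (fun v => f i v (θ * V i.succ + (1 - θ) * W i.succ))
        (θ * V i.castSucc + (1 - θ) * W i.castSucc)) (by
        intro θ hθ
        rw [Set.uIoc_of_le zero_le_one] at hθ
        rw [(partial1 (f i) (hf1 i) _ _).deriv]
        exact h1 i _ _ (seg_abs hθ.1.le hθ.2 (hV _) (hW _)) (seg_abs hθ.1.le hθ.2 (hV _) (hW _)))
    simp only [sub_zero, abs_one, mul_one, Real.norm_eq_abs] at this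
    unfold Aint
    linarith [e1 i]
  · have := intervalIntegral.norm_integral_le_of_norm_le_const (a := (0 : ℝ)) (b := 1) (C := K2 i)
      (f := fun θ => deriv (fun w => f i (θ * V i.castSucc + (1 - θ) * W i.castSucc) w)
      (θ * V i.succ + (1 - θ) * W i.succ)) (by
        intro θ hθ
        rw [Set.uIoc_of_le zero_le_one] at hθ
        rw [(partial2 (f i) (hf1 i) _ _).deriv]
        exact h2 i _ _ (seg_abs hθ.1.le hθ.2 (hV _) (hW _)) (seg_abs hθ.1.le hθ.2 (hV _) (hW _)))
    simp only [sub_zero, abs_one, mul_one, Real.norm_eq_abs] at this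
    unfold Bint
    linarith [e2 i]

/-- norm equivalence, upper -/
theorem N_upper {d : ℕ} (N : (Fin d → ℝ) → ℝ) (h0 : ∀ x, 0 ≤ N x)
    (hs : ∀ (c : ℝ) (x), N (c • x) = |c| * N x) (ht : ∀ x y, N (x + y) ≤ N x + N y) :
    ∃ c : ℝ, 0 ≤ c ∧ ∀ x, N x ≤ c * onenorm x := by
  have hz : N 0 = 0 := by simpa using hs 0 0
  have hsum : ∀ (s : Finset (Fin d)) (g : Fin d → Fin d → ℝ), N (∑ i ∈ s, g i) ≤ ∑ i ∈ s, N (g i) := by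
    intro s g
    induction s using Finset.induction_on with
    | empty => simp [hz]
    | insert a s ha ih => rw [Finset.sum_insert ha, Finset.sum_insert ha]; linarith [ht (g a) (∑ i ∈ s, g i)]
  refine ⟨∑ i, N (Pi.single i 1), Finset.sum_nonneg fun i _ => h0 _, fun x => ?_⟩
  have hx : x = ∑ i, x i • (Pi.single i (1 : ℝ) : Fin d → ℝ) := by
    ext k; simp [Finset.sum_apply, Pi.single_apply]
  calc N x = N (∑ i, x i • (Pi.single i (1 : ℝ) : Fin d → ℝ)) := by rw [← hx]
    _ ≤ ∑ i, N (x i • (Pi.single i (1 : ℝ) : Fin d → ℝ)) := hsum _ _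
    _ = ∑ i, |x i| * N (Pi.single i 1) := by simp only [hs]
    _ ≤ ∑ i, onenorm x * N (Pi.single i 1) :=
      Finset.sum_le_sum fun i _ => mul_le_mul_of_nonneg_right (abs_le_onenorm x i) (h0 _)
    _ = _ := by rw [← Finset.mul_sum, mul_comm]

theorem N_lower {d : ℕ} (N : (Fin d → ℝ) → ℝ) (h0 : ∀ x, 0 ≤ N x) (hd : ∀ x, N x = 0 ↔ x = 0)
    (hs : ∀ (c : ℝ) (x), N (c • x) = |c| * N x) (ht : ∀ x y, N (x + y) ≤ N x + N y) :
    ∃ c : ℝ, 0 ≤ c ∧ ∀ x, onenorm x ≤ c * N x := by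
  obtain ⟨c, hc, hN⟩ := N_upper N h0 hs ht
  have hone : ∀ x : Fin d → ℝ, onenorm x ≤ d * ‖x‖ := fun x => by
    calc onenorm x ≤ ∑ _i : Fin d, ‖x‖ := Finset.sum_le_sum fun i _ => norm_le_pi_norm x i
      _ = _ := by simp
  have hdiff : ∀ x y, |N x - N y| ≤ c * d * ‖x - y‖ := by
    have key : ∀ x y, N x - N y ≤ c * d * ‖x - y‖ := fun x y => by
      have := ht (x - y) y
      rw [sub_add_cancel] at this
      have h2 := hN (x - y)
      have := mul_le_mul_of_nonneg_left (hone (x - y)) hc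
      nlinarith
    intro x y
    rw [abs_le]
    have := key y x
    rw [norm_sub_rev] at this
    exact ⟨by linarith, key x y⟩
  have hcont : Continuous N := by
    refine (LipschitzWith.of_dist_le_mul (K := ⟨c * d, by positivity⟩) fun x y => ?_).continuous
    rw [dist_eq_norm, dist_eq_norm]
    exact hdiff x y
  by_cases hne : (Metric.sphere (0 : Fin d → ℝ) 1).Nonempty
  · obtain ⟨z, hz, hmin⟩ := (isCompact_sphere (0 : Fin d → ℝ) 1).exists_isMinOn hne hcont.continuousOn
    have hzp : 0 < N z := by
      refine lt_of_le_of_ne (h0 z) fun h => ?_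
      have := (hd z).1 h.symm
      simp [this] at hz
    refine ⟨d * (N z)⁻¹, by positivity, fun x => ?_⟩
    by_cases hx : x = 0
    · subst hx
      have : N 0 = 0 := (hd 0).2 rfl
      rw [this]; simp [onenorm]
    · have hxn : 0 < ‖x‖ := norm_pos_iff.2 hx
      have hm : N z ≤ N (‖x‖⁻¹ • x) := hmin (by simp [norm_smul, hxn.ne'])
      rw [hs, abs_of_pos (by positivity)] at hm
      have : ‖x‖ ≤ (N z)⁻¹ * N x := by
        rw [inv_mul_eq_div, le_div_iff₀ hzp]
        rw [inv_mul_eq_div, le_div_iff₀ hxn] at hm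
        linarith
      calc onenorm x ≤ d * ‖x‖ := hone x
        _ ≤ d * ((N z)⁻¹ * N x) := by gcongr
        _ = _ := by ring
  · refine ⟨0, le_rfl, fun x => ?_⟩
    have : x = 0 := by
      by_contra hx
      have hxn : 0 < ‖x‖ := norm_pos_iff.2 hx
      exact hne ⟨‖x‖⁻¹ • x, by simp [norm_smul, hxn.ne']⟩
    subst this; simp [onenorm]

theorem Q_le_F (m : ℕ) (f : Fin (m + 1) → ℝ → ℝ → ℝ) (U : Fin (m + 2) → ℝ) :
    onenorm (Qr m f U) ≤ 2 * onenorm (Fv m f U) := by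
  have e : onenorm (Qr m f U) =
      ∑ k, ((SignType.sign (Qr m f U k) : SignType) : ℝ) * Qr m f U k := by
    unfold onenorm
    simp only [sign_mul_self]
  rw [e, sum_mul_Qr m f U (fun k => ((SignType.sign (Qr m f U k) : SignType) : ℝ))]
  unfold onenorm
  rw [Finset.mul_sum]
  refine Finset.sum_le_sum fun i _ => ?_
  have a := sign_mul_le (Qr m f U i.castSucc) (Fv m f U i)
  have b := sign_mul_le (Qr m f U i.succ) (-Fv m f U i)
  rw [abs_neg] at b
  linarith

theorem F_le_Q (m : ℕ) (f : Fin (m + 1) → ℝ → ℝ → ℝ) (U : Fin (m + 2) → ℝ) :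
    onenorm (Fv m f U) ≤ (m + 1) * onenorm (Qr m f U) := by
  have key : ∀ i, |Fv m f U i| ≤ onenorm (Qr m f U) := by
    intro i
    have h := sum_mul_Qr m f U (fun k => if (k : ℕ) ≤ i then 1 else 0)
    have h2 : ∑ l : Fin (m + 1), ((if ((l.castSucc : Fin (m + 2)) : ℕ) ≤ i then (1 : ℝ) else 0)
        - if ((l.succ : Fin (m + 2)) : ℕ) ≤ i then 1 else 0) * Fv m f U l = Fv m f U i := by
      rw [Finset.sum_eq_single i]
      · simp
      · intro l _ hl
        have : (l : ℕ) ≠ i := fun h => hl (Fin.ext h)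
        simp only [Fin.val_castSucc, Fin.val_succ]
        by_cases h : (l : ℕ) ≤ i
        · have : (l : ℕ) + 1 ≤ i := by omega
          simp [h, this]
        · have : ¬ (l : ℕ) + 1 ≤ i := by omega
          simp [h, this]
      · simp
    rw [← h2, ← h]
    refine (Finset.abs_sum_le_sum_abs _ _).trans (Finset.sum_le_sum fun k _ => ?_)
    split_ifs <;> simp
  calc onenorm (Fv m f U) ≤ ∑ _i : Fin (m + 1), onenorm (Qr m f U) :=
        Finset.sum_le_sum fun i _ => key i
    _ = _ := by simp

/-- transport term -/
noncomputable def Tt {r : ℕ} (lam : Fin r → ℝ) (μ : ℝ) (u : ℤ → Fin r → ℝ) (j : ℤ) : Fin r → ℝ :=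
  fun i => μ * ((lam i + |lam i|) / 2 * (u j i - u (j - 1) i)
    + (lam i - |lam i|) / 2 * (u (j + 1) i - u j i))

theorem Tt_le {r : ℕ} (lam : Fin r → ℝ) (μ : ℝ) (hμ : 0 ≤ μ) (u : ℤ → Fin r → ℝ) (j : ℤ) :
    onenorm (Tt lam μ u j) ≤ μ * onenorm lam *
      (onenorm (u j - u (j - 1)) + onenorm (u (j + 1) - u j)) := by
  have e : ∀ i, |Tt lam μ u j i| ≤ μ * |lam i| *
      (onenorm (u j - u (j - 1)) + onenorm (u (j + 1) - u j)) := by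
    intro i
    unfold Tt
    have h1 := abs_le_onenorm (u j - u (j - 1)) i
    have h2 := abs_le_onenorm (u (j + 1) - u j) i
    rw [Pi.sub_apply] at h1 h2
    have p1 : |(lam i + |lam i|) / 2| ≤ |lam i| := by
      have := neg_abs_le (lam i); have := le_abs_self (lam i); have := abs_nonneg (lam i)
      rw [abs_le]; constructor <;> linarith
    have p2 : |(lam i - |lam i|) / 2| ≤ |lam i| := by
      have := neg_abs_le (lam i); have := le_abs_self (lam i); have := abs_nonneg (lam i)
      rw [abs_le]; constructor <;> linarith
    rw [abs_mul, abs_of_nonneg hμ, mul_assoc]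
    refine mul_le_mul_of_nonneg_left ?_ hμ
    refine (abs_add_le _ _).trans ?_
    rw [abs_mul, abs_mul, mul_add]
    exact add_le_add (mul_le_mul p1 h1 (abs_nonneg _) (abs_nonneg _))
      (mul_le_mul p2 h2 (abs_nonneg _) (abs_nonneg _))
  calc onenorm (Tt lam μ u j) ≤ ∑ i, μ * |lam i| *
      (onenorm (u j - u (j - 1)) + onenorm (u (j + 1) - u j)) := Finset.sum_le_sum fun i _ => e i
    _ = _ := by rw [← Finset.sum_mul, ← Finset.mul_sum]; rfl

theorem hasSum_shift {a : ℤ → ℝ} {S : ℝ} (h : HasSum a S) (k : ℤ) :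
    HasSum (fun j => a (j + k)) S := (Equiv.addRight k).hasSum_iff.2 h

theorem TVD (m : ℕ) (f : Fin (m + 1) → ℝ → ℝ → ℝ)
    (hf2 : ∀ i w, StrictAnti fun v => f i v w)
    (hf3 : ∀ i v, StrictMono fun w => f i v w) (lam : Fin (m + 2) → ℝ) (μ t : ℝ) (hμ : 0 ≤ μ)
    (ht : 0 ≤ t) (hc : ∀ i, μ * |lam i| ≤ 1) (u v : ℤ → Fin (m + 2) → ℝ)
    (hv : ∀ j i, v j i = (u j i - Tt lam μ u j i) + t * Qr m f (v j) i)
    (hu : Summable (fun j : ℤ => onenorm (u j - u (j - 1)))) :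
    Summable (fun j : ℤ => onenorm (v j - v (j - 1))) ∧
    ∑' j : ℤ, onenorm (v j - v (j - 1)) ≤ ∑' j : ℤ, onenorm (u j - u (j - 1)) := by
  have hs : ∀ i, Summable fun j : ℤ => |u j i - u (j - 1) i| := fun i =>
    Summable.of_nonneg_of_le (fun j => abs_nonneg _)
      (fun j => abs_le_onenorm (u j - u (j - 1)) i) hu
  set S : Fin (m + 2) → ℝ := fun i => ∑' j : ℤ, |u j i - u (j - 1) i|
  have hS : ∀ i, HasSum (fun j : ℤ => |u j i - u (j - 1) i|) (S i) := fun i => (hs i).hasSum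
  have hSu : HasSum (fun j : ℤ => onenorm (u j - u (j - 1))) (∑ i, S i) :=
    hasSum_sum fun i _ => hS i
  let p : Fin (m + 2) → ℝ := fun i => μ * ((lam i + |lam i|) / 2)
  let q : Fin (m + 2) → ℝ := fun i => - (μ * ((lam i - |lam i|) / 2))
  have hp : ∀ i, 0 ≤ p i := fun i => mul_nonneg hμ (by have := neg_abs_le (lam i); linarith)
  have hq : ∀ i, 0 ≤ q i := fun i => by
    have := mul_nonneg hμ (show 0 ≤ -((lam i - |lam i|) / 2) by
      have := le_abs_self (lam i); linarith)
    simp only [q]; linarith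
  have hpq : ∀ i, 0 ≤ 1 - p i - q i := fun i => by
    have := hc i
    simp only [p, q]; linarith
  have hB : HasSum (fun j : ℤ => ∑ i, ((1 - p i - q i) * |u j i - u (j - 1) i|
      + p i * |u (j + -1) i - u (j + -1 - 1) i| + q i * |u (j + 1) i - u (j + 1 - 1) i|))
      (∑ i, ((1 - p i - q i) * S i + p i * S i + q i * S i)) :=
    hasSum_sum fun i _ => (((hS i).mul_left _).add ((hasSum_shift (hS i) (-1)).mul_left _)).add
      ((hasSum_shift (hS i) 1).mul_left _)
  have hB' : ∑ i, ((1 - p i - q i) * S i + p i * S i + q i * S i) = ∑ i, S i :=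
    Finset.sum_congr rfl fun i _ => by ring
  rw [hB'] at hB
  have hle : ∀ j, onenorm (v j - v (j - 1)) ≤ ∑ i, ((1 - p i - q i) * |u j i - u (j - 1) i|
      + p i * |u (j + -1) i - u (j + -1 - 1) i| + q i * |u (j + 1) i - u (j + 1 - 1) i|) := by
    intro j
    refine (implicit_contr m f hf2 hf3 (v j) (v (j - 1)) (u j - Tt lam μ u j)
      (u (j - 1) - Tt lam μ u (j - 1)) t ht (hv j) (hv (j - 1))).trans ?_
    refine Finset.sum_le_sum fun i _ => ?_
    have e : (u j - Tt lam μ u j - (u (j - 1) - Tt lam μ u (j - 1))) i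
        = (1 - p i - q i) * (u j i - u (j - 1) i) + p i * (u (j + -1) i - u (j + -1 - 1) i)
          + q i * (u (j + 1) i - u (j + 1 - 1) i) := by
      simp only [Pi.sub_apply, Tt, p, q, add_sub_cancel_right, sub_add_cancel, ← sub_eq_add_neg]
      ring
    rw [e]
    refine (abs_add_three _ _ _).trans ?_
    rw [abs_mul (1 - p i - q i), abs_mul (p i), abs_mul (q i), abs_of_nonneg (hpq i),
      abs_of_nonneg (hp i), abs_of_nonneg (hq i)]
  have hsv : Summable (fun j : ℤ => onenorm (v j - v (j - 1))) :=
    Summable.of_nonneg_of_le (fun j => onenorm_nonneg' _) hle hB.summable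
  refine ⟨hsv, ?_⟩
  rw [hSu.tsum_eq, ← hB.tsum_eq]
  exact hsv.tsum_le_tsum hle hB.summable

theorem Qr_zero (m : ℕ) (f : Fin (m + 1) → ℝ → ℝ → ℝ) (hf0 : ∀ i, f i 0 0 = 0) :
    Qr m f 0 = 0 := by
  ext k
  simp [Qr, hf0]

theorem zero_step (m : ℕ) (f : Fin (m + 1) → ℝ → ℝ → ℝ)
    (hf2 : ∀ i w, StrictAnti fun v => f i v w)
    (hf3 : ∀ i v, StrictMono fun w => f i v w) (hf0 : ∀ i, f i 0 0 = 0)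
    (lam : Fin (m + 2) → ℝ) (μ t : ℝ)
    (ht : 0 ≤ t) (u v : ℤ → Fin (m + 2) → ℝ)
    (hv : ∀ j i, v j i = (u j i - Tt lam μ u j i) + t * Qr m f (v j) i)
    (hu : ∃ J₀ : ℤ, ∀ j > J₀, u j = 0) : ∃ J₀ : ℤ, ∀ j > J₀, v j = 0 := by
  obtain ⟨J, hJ⟩ := hu
  refine ⟨J + 1, fun j hj => ?_⟩
  have h := implicit_contr m f hf2 hf3 (v j) 0 (u j - Tt lam μ u j) 0 t ht (hv j)
    (fun k => by rw [Qr_zero m f hf0]; simp)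
  have e : u j - Tt lam μ u j - 0 = 0 := by
    ext i
    simp [Tt, hJ j (by omega), hJ (j - 1) (by omega), hJ (j + 1) (by omega)]
  rw [e, sub_zero] at h
  ext i
  have h2 := abs_le_onenorm (v j) i
  have h3 : onenorm (0 : Fin (m + 2) → ℝ) = 0 := by simp [onenorm]
  have : |v j i| ≤ 0 := by linarith
  simpa using this

theorem sup_bound {r : ℕ} (u : ℤ → Fin r → ℝ)
    (hu : Summable (fun j : ℤ => onenorm (u j - u (j - 1))))
    (hz : ∃ J₀ : ℤ, ∀ j > J₀, u j = 0) (j : ℤ) (i : Fin r) :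
    |u j i| ≤ ∑' j : ℤ, onenorm (u j - u (j - 1)) := by
  obtain ⟨J, hJ⟩ := hz
  have ind : ∀ k : ℕ, |u j i| ≤ |u (j + k) i| +
      ∑ l ∈ Finset.range k, onenorm (u (j + l + 1) - u (j + l + 1 - 1)) := by
    intro k
    induction k with
    | zero => simp
    | succ k ih =>
      rw [Finset.sum_range_succ]
      have h := abs_le_onenorm (u (j + k + 1) - u (j + k + 1 - 1)) i
      rw [Pi.sub_apply] at h
      have e : u (j + k) i = u (j + k + 1 - 1) i := by rw [add_sub_cancel_right]
      have e2 : (j + ((k + 1 : ℕ) : ℤ)) = j + k + 1 := by push_cast; ring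
      rw [e2]
      have h3 := abs_sub_abs_le_abs_sub (u (j + k + 1 - 1) i) (u (j + k + 1) i)
      rw [abs_sub_comm] at h3
      rw [e] at ih
      linarith
  have h := ind ((J - j).toNat + 1)
  have hlast : u (j + (((J - j).toNat + 1 : ℕ) : ℤ)) = 0 := hJ _ (by omega)
  rw [hlast] at h
  simp only [Pi.zero_apply, abs_zero, zero_add] at h
  refine h.trans ?_
  have hinj : Function.Injective fun l : ℕ => j + (l : ℤ) + 1 := fun a b hab => by
    simp only at hab; omega
  have := hu.sum_le_tsum ((Finset.range ((J - j).toNat + 1)).map ⟨_, hinj⟩)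
    (fun _ _ => onenorm_nonneg' _)
  rw [Finset.sum_map] at this
  exact this

theorem decay_step (m : ℕ) (f : Fin (m + 1) → ℝ → ℝ → ℝ)
    (hf1 : ∀ i, ContDiff ℝ 1 fun p : ℝ × ℝ => f i p.1 p.2)
    (N : (Fin (m + 1) → ℝ) → ℝ) (lam0 : ℝ)
    (hstar : StarAssumption m f N lam0) (c1 : ℝ) (hc1 : 0 ≤ c1) (hN : ∀ x, N x ≤ c1 * onenorm x)
    (K : ℝ) (hK : 0 ≤ K) (V W T : Fin (m + 2) → ℝ)
    (hA : ∀ i, |Aint m f V W i| ≤ K ∧ |Bint m f V W i| ≤ K)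
    (Δt ε : ℝ) (ht : 0 < Δt) (hε : 0 < ε)
    (hV : ∀ i, V i = (W i - T i) + Δt / ε * Qr m f V i) :
    N (Fv m f V) ≤ (1 + lam0 * Δt / ε)⁻¹ *
      (N (Fv m f W) + c1 * ((m + 1) * (2 * K)) * onenorm T) := by
  obtain ⟨-, -, -, htri, hl0, hM⟩ := hstar
  obtain ⟨hunit, hinv⟩ := hM V W Δt ε ht hε
  set g : Fin (m + 1) → ℝ := fun i =>
    -(Aint m f V W i * T i.castSucc + Bint m f V W i * T i.succ)
  have key : (1 - (Δt / ε) • Mmat m f V W).mulVec (Fv m f V) = Fv m f W + g := by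
    rw [Matrix.sub_mulVec, Matrix.one_mulVec, Matrix.smul_mulVec]
    ext i
    simp only [Pi.sub_apply, Pi.smul_apply, Pi.add_apply, smul_eq_mul, M_mulVec, g]
    have h1 : Fv m f V i - Fv m f W i = Aint m f V W i * (V i.castSucc - W i.castSucc)
      + Bint m f V W i * (V i.succ - W i.succ) :=
      ftc (f i) (hf1 i) (V i.castSucc) (V i.succ) (W i.castSucc) (W i.succ)
    have h2 : V i.castSucc - W i.castSucc = -T i.castSucc + Δt / ε * Qr m f V i.castSucc := by
      linarith [hV i.castSucc]
    have h3 : V i.succ - W i.succ = -T i.succ + Δt / ε * Qr m f V i.succ := by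
      linarith [hV i.succ]
    rw [h2, h3] at h1
    linarith
  have hF : Fv m f V = (1 - (Δt / ε) • Mmat m f V W)⁻¹.mulVec (Fv m f W + g) := by
    rw [← key, Matrix.mulVec_mulVec, Matrix.nonsing_inv_mul _ ((Matrix.isUnit_iff_isUnit_det _).1 hunit),
      Matrix.one_mulVec]
  have hg : onenorm g ≤ (m + 1) * (2 * K) * onenorm T := by
    calc onenorm g ≤ ∑ _i : Fin (m + 1), 2 * K * onenorm T := by
          refine Finset.sum_le_sum fun i _ => ?_
          simp only [g]
          rw [abs_neg]
          refine (abs_add_le _ _).trans ?_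
          rw [abs_mul, abs_mul]
          have := mul_le_mul (hA i).1 (abs_le_onenorm T i.castSucc) (abs_nonneg _) hK
          have := mul_le_mul (hA i).2 (abs_le_onenorm T i.succ) (abs_nonneg _) hK
          linarith
      _ = _ := by simp; ring
  have hinvpos : 0 ≤ (1 + lam0 * Δt / ε)⁻¹ := by
    positivity
  calc N (Fv m f V) ≤ (1 + lam0 * Δt / ε)⁻¹ * N (Fv m f W + g) := by
        conv_lhs => rw [hF]
        exact hinv _
    _ ≤ _ := by
        refine mul_le_mul_of_nonneg_left ?_ hinvpos
        have := htri (Fv m f W) g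
        have := hN g
        have := mul_le_mul_of_nonneg_left hg hc1
        linarith


/-- Let `U` solve the semi-implicit upwind scheme with grid sizes
satisfying the CFL condition, with finite initial total variation (bounded by `TV₀`),
`U_j^0 = 0` for all sufficiently large `j`, and `∑_j |Q(U_j^0)| < ∞`; assume
Assumption (★).  Then there is a constant `C > 0`, independent of `n`, `Δt`, `Δx`, `ε`,
such that for all `n ≥ 0`:
`∑_{j} |Q(U_j^n)| Δx ≤ C ((1 + λΔt/ε)^{-n} ∑_{j} |Q(U_j^0)| Δx + ε)`. -/
theorem stmt11 (m : ℕ) (f : Fin (m + 1) → ℝ → ℝ → ℝ)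
    (hf1 : ∀ i, ContDiff ℝ 1 fun p : ℝ × ℝ => f i p.1 p.2)
    (hf2 : ∀ i w, StrictAnti fun v => f i v w)
    (hf3 : ∀ i v, StrictMono fun w => f i v w)
    (hf0 : ∀ i, f i 0 0 = 0)
    (lam : Fin (m + 2) → ℝ)
    (N : (Fin (m + 1) → ℝ) → ℝ) (lam0 : ℝ)
    (hstar : StarAssumption m f N lam0)
    (TV₀ : ℝ) :
    ∃ C > (0 : ℝ), ∀ (Δt Δx ε : ℝ), 0 < Δt → 0 < Δx → 0 < ε →
      ∀ U : ℕ → ℤ → Fin (m + 2) → ℝ,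
        Scheme m f lam Δt Δx ε U → CFL m lam Δt Δx →
        Summable (fun j : ℤ => onenorm (U 0 j - U 0 (j - 1))) →
        (∑' j : ℤ, onenorm (U 0 j - U 0 (j - 1))) ≤ TV₀ →
        (∃ J₀ : ℤ, ∀ j > J₀, U 0 j = 0) →
        Summable (fun j : ℤ => onenorm (Qr m f (U 0 j))) →
        ∀ n : ℕ,
          Summable (fun j : ℤ => onenorm (Qr m f (U n j))) ∧
          (∑' j : ℤ, onenorm (Qr m f (U n j)) * Δx)
            ≤ C * (((1 + lam0 * Δt / ε) ^ n)⁻¹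
                * (∑' j : ℤ, onenorm (Qr m f (U 0 j)) * Δx) + ε) := by
  have hstar' := hstar
  obtain ⟨h0, hd, hs, htri, hl0, -⟩ := hstar'
  obtain ⟨c1, hc1, hN1⟩ := N_upper N h0 hs htri
  obtain ⟨c2, hc2, hN2⟩ := N_lower N h0 hd hs htri
  obtain ⟨K, hK, hAB⟩ := AB_bdd m f hf1 |TV₀|
  have hL : 0 ≤ onenorm lam := onenorm_nonneg' _
  set c3 : ℝ := c1 * ((m + 1) * (2 * K)) * (onenorm lam * 2 * |TV₀|) with hc3
  have hc3p : 0 ≤ c3 := by positivity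
  have hcA : 0 ≤ 2 * c2 * (c1 * (m + 1)) := by positivity
  have hcB : 0 ≤ 2 * c2 * (c3 / lam0) := by positivity
  refine ⟨2 * c2 * (c1 * (m + 1)) + 2 * c2 * (c3 / lam0) + 1, by positivity, ?_⟩
  intro Δt Δx ε ht hx hε U hsch hcfl hsum hTV hzero hQ0
  have hμ : 0 ≤ Δt / Δx := by positivity
  have hte : 0 ≤ Δt / ε := by positivity
  have hTVle : TV₀ ≤ |TV₀| := le_abs_self _
  have hstep : ∀ n j i, U (n + 1) j i =
      (U n j i - Tt lam (Δt / Δx) (U n) j i) + Δt / ε * Qr m f (U (n + 1) j) i := by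
    intro n j i
    have h := hsch n j i
    unfold Tt
    field_simp at h ⊢
    linarith
  have hall : ∀ n, (Summable (fun j : ℤ => onenorm (U n j - U n (j - 1))) ∧
      ∑' j : ℤ, onenorm (U n j - U n (j - 1)) ≤ |TV₀|) ∧ ∃ J₀ : ℤ, ∀ j > J₀, U n j = 0 := by
    intro n
    induction n with
    | zero => exact ⟨⟨hsum, hTV.trans hTVle⟩, hzero⟩
    | succ n ih =>
      obtain ⟨⟨a, b⟩, c⟩ := ih
      have h := TVD m f hf2 hf3 lam _ _ hμ hte hcfl (U n) (U (n + 1)) (hstep n) a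
      exact ⟨⟨h.1, h.2.trans b⟩,
        zero_step m f hf2 hf3 hf0 lam _ _ hte (U n) (U (n + 1)) (hstep n) c⟩
  have hbd : ∀ n j i, |U n j i| ≤ |TV₀| := fun n j i =>
    (sup_bound (U n) (hall n).1.1 (hall n).2 j i).trans (hall n).1.2
  set q : ℝ := (1 + lam0 * Δt / ε)⁻¹ with hq
  have hqp : 0 ≤ q := by positivity
  have hdec : ∀ n, Summable (fun j => N (Fv m f (U n j))) → 
      Summable (fun j => N (Fv m f (U (n + 1) j))) ∧
      ∑' j, N (Fv m f (U (n + 1) j)) ≤ q * (∑' j, N (Fv m f (U n j)) + c3 * (Δt / Δx)) := by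
    intro n hn
    obtain ⟨⟨hsa, hta⟩, -⟩ := hall n
    have hle : ∀ j, N (Fv m f (U (n + 1) j)) ≤ q * (N (Fv m f (U n j)) +
        c1 * ((m + 1) * (2 * K)) * (Δt / Δx * onenorm lam *
        (onenorm (U n j - U n (j - 1)) + onenorm (U n (j + 1) - U n (j + 1 - 1))))) := by
      intro j
      refine (decay_step m f hf1 N lam0 hstar c1 hc1 hN1 K hK (U (n + 1) j) (U n j)
        (Tt lam (Δt / Δx) (U n) j) (hAB _ _ (hbd _ _) (hbd _ _)) Δt ε ht hε
        (hstep n j)).trans ?_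
      refine mul_le_mul_of_nonneg_left ?_ hqp
      have := Tt_le lam (Δt / Δx) hμ (U n) j
      rw [add_sub_cancel_right]
      have := mul_le_mul_of_nonneg_left this (show 0 ≤ c1 * ((m + 1) * (2 * K)) by positivity)
      linarith
    have hB := (hn.hasSum.add (((hsa.hasSum.add (hasSum_shift hsa.hasSum 1)).mul_left
      (Δt / Δx * onenorm lam)).mul_left (c1 * ((m + 1) * (2 * K))))).mul_left q
    have hsv := Summable.of_nonneg_of_le (fun j => h0 _) hle hB.summable
    refine ⟨hsv, ?_⟩
    refine (hsv.tsum_le_tsum hle hB.summable).trans ?_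
    rw [hB.tsum_eq]
    refine mul_le_mul_of_nonneg_left ?_ hqp
    refine add_le_add le_rfl ?_
    rw [hc3]
    have h5 : 0 ≤ c1 * ((m + 1) * (2 * K)) * (Δt / Δx * onenorm lam) := by positivity
    have := mul_le_mul_of_nonneg_left hta h5
    linarith
  set E : ℝ := c3 * ε / (lam0 * Δx) with hE
  have hqE : q * (E + c3 * (Δt / Δx)) = E := by
    rw [hq, hE]
    have : 0 < 1 + lam0 * Δt / ε := by positivity
    rw [inv_mul_eq_iff_eq_mul₀ this.ne']
    field_simp
  have hF0 : ∀ j, N (Fv m f (U 0 j)) ≤ c1 * (m + 1) * onenorm (Qr m f (U 0 j)) := fun j => by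
    have := hN1 (Fv m f (U 0 j))
    have := mul_le_mul_of_nonneg_left (F_le_Q m f (U 0 j)) hc1
    linarith
  have hS0 : Summable (fun j => N (Fv m f (U 0 j))) :=
    Summable.of_nonneg_of_le (fun j => h0 _) hF0 (hQ0.mul_left _)
  have hS0le : ∑' j, N (Fv m f (U 0 j)) ≤ c1 * (m + 1) * ∑' j, onenorm (Qr m f (U 0 j)) := by
    rw [← tsum_mul_left]
    exact hS0.tsum_le_tsum hF0 (hQ0.mul_left _)
  have hmain : ∀ n, Summable (fun j => N (Fv m f (U n j))) ∧
      ∑' j, N (Fv m f (U n j)) ≤ q ^ n * ∑' j, N (Fv m f (U 0 j)) + E := by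
    intro n
    induction n with
    | zero =>
      refine ⟨hS0, ?_⟩
      have : 0 ≤ E := by positivity
      simp only [pow_zero, one_mul]; linarith
    | succ n ih =>
      obtain ⟨a, b⟩ := hdec n ih.1
      refine ⟨a, b.trans ?_⟩
      have := mul_le_mul_of_nonneg_left ih.2 hqp
      rw [pow_succ]
      linarith
  intro n
  obtain ⟨hn, hnle⟩ := hmain n
  have hQn : ∀ j, onenorm (Qr m f (U n j)) ≤ 2 * c2 * N (Fv m f (U n j)) := fun j => by
    have := Q_le_F m f (U n j)
    have := hN2 (Fv m f (U n j))
    linarith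
  have hQs : Summable (fun j : ℤ => onenorm (Qr m f (U n j))) :=
    Summable.of_nonneg_of_le (fun j => onenorm_nonneg' _) hQn (hn.mul_left _)
  refine ⟨hQs, ?_⟩
  have hQle : ∑' j, onenorm (Qr m f (U n j)) ≤ 2 * c2 * ∑' j, N (Fv m f (U n j)) := by
    rw [← tsum_mul_left]
    exact hQs.tsum_le_tsum hQn (hn.mul_left _)
  rw [tsum_mul_right, tsum_mul_right, ← inv_pow, ← hq]
  set X := ∑' j, onenorm (Qr m f (U 0 j)) with hX
  have hXp : 0 ≤ X := tsum_nonneg fun j => onenorm_nonneg' _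
  have hEx : E * Δx = c3 / lam0 * ε := by rw [hE]; field_simp
  have hqn : 0 ≤ q ^ n := by positivity
  calc (∑' j, onenorm (Qr m f (U n j))) * Δx
      ≤ (2 * c2 * (q ^ n * (c1 * (m + 1) * X) + E)) * Δx := by
        refine mul_le_mul_of_nonneg_right (hQle.trans ?_) hx.le
        refine mul_le_mul_of_nonneg_left (hnle.trans ?_) (by positivity)
        exact add_le_add (mul_le_mul_of_nonneg_left hS0le hqn) le_rfl
    _ = 2 * c2 * (c1 * (m + 1)) * (q ^ n * (X * Δx)) + 2 * c2 * (E * Δx) := by ring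
    _ = 2 * c2 * (c1 * (m + 1)) * (q ^ n * (X * Δx)) + 2 * c2 * (c3 / lam0) * ε := by
        rw [hEx]; ring
    _ ≤ _ := by
        have hY : 0 ≤ q ^ n * (X * Δx) := by positivity
        have := mul_nonneg hcA hε.le
        have := mul_nonneg hcB hY
        linarith
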